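/- Let [x]_ap be an ap-quasiattractor contained in M_1 that is isolated, i.e. it admits an open neighborhood disjoint from every other ap-basic class. Then [x]_ap is an attractor for F. -/

import Mathlib

open MeasureTheory ProbabilityTheory Metric Set Filter Topology
open scoped ENNReal NNReal

noncomputable section

namespace QSDPaper

variable {d : ℕ}

/-- An absorption-preserving (ap) `δ`-pseudoorbit `ξ_0, …, ξ_n` in `M`. -/
def IsApOrbit (F : (Fin d → ℝ) → Fin d → ℝ) (M M0 : Set (Fin d → ℝ)) (δ : ℝ)
    (n : ℕ) (ξ : ℕ → Fin d → ℝ) : Prop :=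
  1 ≤ n ∧ (∀ i ≤ n, ξ i ∈ M) ∧ (∀ i < n, ξ i ∈ M0 → ξ (i + 1) ∈ M0) ∧
    ∀ i < n, dist (ξ (i + 1)) (F (ξ i)) < δ

/-- `x <_ap y`: for every `δ > 0` there is an ap `δ`-pseudoorbit joining `x` to `y`. -/
def apLe (F : (Fin d → ℝ) → Fin d → ℝ) (M M0 : Set (Fin d → ℝ)) (x y : Fin d → ℝ) : Prop :=
  ∀ δ > (0 : ℝ), ∃ n ξ, IsApOrbit F M M0 δ n ξ ∧ ξ 0 = x ∧ ξ n = y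

/-- `x ∼_ap y`. -/
def apEquiv (F : (Fin d → ℝ) → Fin d → ℝ) (M M0 : Set (Fin d → ℝ)) (x y : Fin d → ℝ) : Prop :=
  apLe F M M0 x y ∧ apLe F M M0 y x

/-- The set `R_ap` of ap-chain recurrent points. -/
def apRec (F : (Fin d → ℝ) → Fin d → ℝ) (M M0 : Set (Fin d → ℝ)) : Set (Fin d → ℝ) :=
  {x | apEquiv F M M0 x x}

/-- The ap-basic class of `x`. -/
def apClass (F : (Fin d → ℝ) → Fin d → ℝ) (M M0 : Set (Fin d → ℝ)) (x : Fin d → ℝ) :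
    Set (Fin d → ℝ) :=
  {y | y ∈ apRec F M M0 ∧ apEquiv F M M0 x y}

/-- `[x]_ap` is a maximal ap-basic class. -/
def IsApQuasiattractor (F : (Fin d → ℝ) → Fin d → ℝ) (M M0 : Set (Fin d → ℝ))
    (x : Fin d → ℝ) : Prop :=
  x ∈ apRec F M M0 ∧ ∀ y ∈ apRec F M M0, apLe F M M0 x y → apEquiv F M M0 x y

/-- A compact set `A` is an attractor for `F : M → M`. -/
def IsAttractor (F : (Fin d → ℝ) → Fin d → ℝ) (M A : Set (Fin d → ℝ)) : Prop :=
  IsCompact A ∧ A ⊆ M ∧ ∃ U : Set (Fin d → ℝ), IsOpen U ∧ A ⊆ U ∧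
    (⋂ n ∈ {k : ℕ | 1 ≤ k}, F^[n] '' (U ∩ M)) = A ∧
    ∀ V : Set (Fin d → ℝ), IsOpen V → A ⊆ V → ∃ N : ℕ, ∀ n ≥ N, F^[n] '' (U ∩ M) ⊆ V

/-- The ω-limit set of `x` under `F`. -/
def omegaSet (F : (Fin d → ℝ) → Fin d → ℝ) (x : Fin d → ℝ) : Set (Fin d → ℝ) :=
  {y | ∃ φ : ℕ → ℕ, StrictMono φ ∧ Tendsto (fun k => F^[φ k] x) atTop (𝓝 y)}

/-- The nonwandering set of `F` on `M`. -/
def nonwanderingSet (F : (Fin d → ℝ) → Fin d → ℝ) (M : Set (Fin d → ℝ)) :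
    Set (Fin d → ℝ) :=
  {x ∈ M | ∀ U : Set (Fin d → ℝ), IsOpen U → x ∈ U → ∀ N : ℕ,
    ∃ n ≥ N, ((F^[n] '' (U ∩ M)) ∩ (U ∩ M)).Nonempty}

/-- `β_δ(ε) = sup_{x ∈ M} p^ε(x, M \ N^δ(F x))`. -/
def beta (p : ℝ → Kernel (Fin d → ℝ) (Fin d → ℝ)) (F : (Fin d → ℝ) → Fin d → ℝ)
    (M : Set (Fin d → ℝ)) (δ ε : ℝ) : ℝ≥0∞ :=
  ⨆ x ∈ M, p ε x (M \ ball (F x) δ)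

/-- `μ` is a quasi-stationary distribution for `κ` on `M1` with eigenvalue `lam ∈ (0,1)`. -/
def IsQSD (κ : Kernel (Fin d → ℝ) (Fin d → ℝ)) (M1 : Set (Fin d → ℝ))
    (μ : Measure (Fin d → ℝ)) (lam : ℝ) : Prop :=
  IsProbabilityMeasure μ ∧ μ M1 = 1 ∧ 0 < lam ∧ lam < 1 ∧
    ∀ Γ : Set (Fin d → ℝ), MeasurableSet Γ → Γ ⊆ M1 →
      ∫⁻ x in M1, κ x Γ ∂μ = ENNReal.ofReal lam * μ Γ

/-- Weak* convergence of a sequence of measures (tested against bounded continuous functions). -/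
def WeaklyTendsto (μs : ℕ → Measure (Fin d → ℝ)) (μ : Measure (Fin d → ℝ)) : Prop :=
  ∀ g : BoundedContinuousFunction (Fin d → ℝ) ℝ,
    Tendsto (fun n => ∫ x, g x ∂μs n) atTop (𝓝 (∫ x, g x ∂μ))

/-- `stayProb κ V n x = P_x[X_0, …, X_n ∈ V] = P_x[τ_V > n]` for the Markov chain with
transition kernel `κ` started at `x`, where `τ_V = min {n : X_n ∉ V}`. -/
def stayProb (κ : Kernel (Fin d → ℝ) (Fin d → ℝ)) (V : Set (Fin d → ℝ)) :
    ℕ → (Fin d → ℝ) → ℝ≥0∞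
  | 0, x => V.indicator 1 x
  | n + 1, x => V.indicator (fun z => ∫⁻ y, stayProb κ V n y ∂κ z) x

/-- `tubeProb κ η n ξ x = P_x[dist (X_j, ξ_j) < η for j = 1, …, n]` for the Markov chain
with transition kernel `κ` started at `x`. -/
def tubeProb (κ : Kernel (Fin d → ℝ) (Fin d → ℝ)) (η : ℝ) :
    ℕ → (ℕ → Fin d → ℝ) → (Fin d → ℝ) → ℝ≥0∞
  | 0, _, _ => 1
  | n + 1, ξ, x => ∫⁻ y in ball (ξ 1) η, tubeProb κ η n (fun k => ξ (k + 1)) y ∂κ x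

/-- `A_n(ξ) = Σ_{i<n} ρ(ξ_i, ξ_{i+1})`. -/
def rhoCost (ρ : (Fin d → ℝ) → (Fin d → ℝ) → ℝ≥0∞) (n : ℕ) (ξ : ℕ → Fin d → ℝ) : ℝ≥0∞ :=
  ∑ i ∈ Finset.range n, ρ (ξ i) (ξ (i + 1))

/-- `B_ρ(x,y)`: minimal cost of a finite path in `M` from `x` to `y`. -/
def Brho (ρ : (Fin d → ℝ) → (Fin d → ℝ) → ℝ≥0∞) (M : Set (Fin d → ℝ))
    (x y : Fin d → ℝ) : ℝ≥0∞ :=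
  ⨅ (n : ℕ) (_ : 1 ≤ n) (ξ : ℕ → Fin d → ℝ)
    (_ : (∀ i ≤ n, ξ i ∈ M) ∧ ξ 0 = x ∧ ξ n = y), rhoCost ρ n ξ

/-- `x <_ρ y`. -/
def rhoLe (ρ : (Fin d → ℝ) → (Fin d → ℝ) → ℝ≥0∞) (M : Set (Fin d → ℝ))
    (x y : Fin d → ℝ) : Prop :=
  Brho ρ M x y = 0

/-- `x ∼_ρ y`. -/
def rhoEquiv (ρ : (Fin d → ℝ) → (Fin d → ℝ) → ℝ≥0∞) (M : Set (Fin d → ℝ))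
    (x y : Fin d → ℝ) : Prop :=
  rhoLe ρ M x y ∧ rhoLe ρ M y x

/-- The ρ-chain recurrent set `R_ρ`. -/
def rhoRec (ρ : (Fin d → ℝ) → (Fin d → ℝ) → ℝ≥0∞) (M : Set (Fin d → ℝ)) :
    Set (Fin d → ℝ) :=
  {x | rhoEquiv ρ M x x}

/-- The ρ-basic class of `x`. -/
def rhoClass (ρ : (Fin d → ℝ) → (Fin d → ℝ) → ℝ≥0∞) (M : Set (Fin d → ℝ))
    (x : Fin d → ℝ) : Set (Fin d → ℝ) :=
  {y | y ∈ rhoRec ρ M ∧ rhoEquiv ρ M x y}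

/-- `[x]_ρ` is a maximal ρ-basic class. -/
def IsRhoQuasiattractor (ρ : (Fin d → ℝ) → (Fin d → ℝ) → ℝ≥0∞) (M : Set (Fin d → ℝ))
    (x : Fin d → ℝ) : Prop :=
  x ∈ rhoRec ρ M ∧ ∀ y ∈ rhoRec ρ M, rhoLe ρ M x y → rhoEquiv ρ M x y

/-- Properties (i)–(iii) of Hypothesis 2.4 for the rate function `ρ`. -/
def HypRho (F : (Fin d → ℝ) → Fin d → ℝ) (M M0 : Set (Fin d → ℝ))
    (ρ : (Fin d → ℝ) → (Fin d → ℝ) → ℝ≥0∞) : Prop :=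
  ContinuousOn (fun q : (Fin d → ℝ) × (Fin d → ℝ) => ρ q.1 q.2) ((M \ M0) ×ˢ M) ∧
  (∀ x ∈ M, ∀ y ∈ M, (ρ x y = 0 ↔ y = F x)) ∧
  (∀ β : ℝ, 0 < β → ∃ c : ℝ≥0∞, 0 < c ∧ ∀ x ∈ M, ∀ y ∈ M, β < dist (F x) y → c ≤ ρ x y)

/-- Property (iv) of Hypothesis 2.4: large deviation upper and lower bounds. -/
def HypLD (p : ℝ → Kernel (Fin d → ℝ) (Fin d → ℝ)) (F : (Fin d → ℝ) → Fin d → ℝ)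
    (M M0 : Set (Fin d → ℝ)) (ρ : (Fin d → ℝ) → (Fin d → ℝ) → ℝ≥0∞) : Prop :=
  (∀ K : Set (Fin d → ℝ), IsCompact K → K ⊆ M \ M0 → ∀ z : Fin d → ℝ, ∀ r > (0 : ℝ),
    ∀ η > (0 : ℝ), ∀ᶠ ε : ℝ in 𝓝[>] (0 : ℝ), ∀ x ∈ K,
      -(((⨅ y ∈ ball z r ∩ M, ρ x y : ℝ≥0∞) : EReal)) - (η : EReal)
        ≤ (ε : EReal) * ENNReal.log (p ε x (ball z r ∩ M))) ∧
  (∀ C : Set (Fin d → ℝ), IsClosed C → C ⊆ M → ∀ η > (0 : ℝ),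
    ∀ᶠ ε : ℝ in 𝓝[>] (0 : ℝ), ∀ x ∈ M,
      (ε : EReal) * ENNReal.log (p ε x C) + ((⨅ y ∈ C, ρ x y : ℝ≥0∞) : EReal) ≤ (η : EReal))

/-- Hypothesis 2.5: absorption is not too unlikely near the absorbing set. -/
def HypAbs (p : ℝ → Kernel (Fin d → ℝ) (Fin d → ℝ)) (M M0 : Set (Fin d → ℝ)) : Prop :=
  ∀ c > (0 : ℝ), ∃ V0 : Set (Fin d → ℝ), IsOpen V0 ∧ M0 ⊆ V0 ∧
    (-(c : EReal)) ≤
      Filter.liminf (fun ε : ℝ => ⨅ x ∈ V0 ∩ M, (ε : EReal) * ENNReal.log (p ε x M0))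
        (𝓝[>] (0 : ℝ))

/-- The (topological) support of a measure. -/
def measSupport (μ : Measure (Fin d → ℝ)) : Set (Fin d → ℝ) :=
  {x | ∀ U : Set (Fin d → ℝ), IsOpen U → x ∈ U → 0 < μ U}

/-- one step -/
def apStep (F : (Fin d → ℝ) → Fin d → ℝ) (M M0 : Set (Fin d → ℝ)) (δ : ℝ)
    (a b : Fin d → ℝ) : Prop :=
  a ∈ M ∧ b ∈ M ∧ (a ∈ M0 → b ∈ M0) ∧ dist b (F a) < δ

/-- chain -/
def apR (F : (Fin d → ℝ) → Fin d → ℝ) (M M0 : Set (Fin d → ℝ)) (δ : ℝ)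
    (a b : Fin d → ℝ) : Prop := Relation.TransGen (apStep F M M0 δ) a b

theorem orbit_iff (F : (Fin d → ℝ) → Fin d → ℝ) (M M0 : Set (Fin d → ℝ)) (δ : ℝ)
    (a b : Fin d → ℝ) :
    (∃ n ξ, IsApOrbit F M M0 δ n ξ ∧ ξ 0 = a ∧ ξ n = b) ↔ apR F M M0 δ a b := by
  constructor
  · rintro ⟨n, ξ, ⟨hn, hM, h0, hd⟩, rfl, rfl⟩
    have key : ∀ k, k + 1 ≤ n → apR F M M0 δ (ξ 0) (ξ (k + 1)) := by
      intro k
      induction k with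
      | zero =>
        intro hk
        exact Relation.TransGen.single
          ⟨hM 0 (by omega), hM _ hk, h0 0 (by omega), hd 0 (by omega)⟩
      | succ k ih =>
        intro hk
        exact Relation.TransGen.tail (ih (by omega))
          ⟨hM _ (by omega), hM _ hk, h0 _ (by omega), hd _ (by omega)⟩
    obtain ⟨k, rfl⟩ : ∃ k, n = k + 1 := ⟨n - 1, by omega⟩
    exact key k le_rfl
  · intro h
    induction h with
    | @single b h =>
      obtain ⟨h1, h2, h3, h4⟩ := h
      refine ⟨1, fun i => if i = 0 then a else b, ⟨le_rfl, ?_, ?_, ?_⟩, by simp, by simp⟩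
      · intro i _
        by_cases hi : i = 0 <;> simp [hi, h1, h2]
      · intro i hi
        obtain rfl : i = 0 := by omega
        simpa using h3
      · intro i hi
        obtain rfl : i = 0 := by omega
        simpa using h4
    | @tail b c _ h ih =>
      obtain ⟨h1, h2, h3, h4⟩ := h
      obtain ⟨n, ξ, ⟨hn, hM, h0, hd⟩, ha, hb⟩ := ih
      refine ⟨n + 1, fun i => if i ≤ n then ξ i else c, ⟨by omega, ?_, ?_, ?_⟩, by simpa using ha,
        by simp⟩
      · intro i _
        by_cases hi : i ≤ n
        · simp [hi, hM]
        · simp [hi, h2]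
      · intro i hi
        by_cases hi' : i < n
        · have e1 : i ≤ n := by omega
          have e2 : i + 1 ≤ n := by omega
          simpa [e1, e2] using h0 i hi'
        · obtain rfl : i = n := by omega
          simpa [hb] using h3
      · intro i hi
        by_cases hi' : i < n
        · have e1 : i ≤ n := by omega
          have e2 : i + 1 ≤ n := by omega
          simpa [e1, e2] using hd i hi'
        · obtain rfl : i = n := by omega
          simpa [hb] using h4

theorem apLe_iff (F : (Fin d → ℝ) → Fin d → ℝ) (M M0 : Set (Fin d → ℝ)) 
    (a b : Fin d → ℝ) : apLe F M M0 a b ↔ ∀ δ > 0, apR F M M0 δ a b := by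
  unfold apLe
  simp only [orbit_iff]

theorem apLe_trans {F : (Fin d → ℝ) → Fin d → ℝ} {M M0 : Set (Fin d → ℝ)} 
    {a b c : Fin d → ℝ} (h1 : apLe F M M0 a b) (h2 : apLe F M M0 b c) : apLe F M M0 a c := by
  rw [apLe_iff] at *
  exact fun δ hδ => Relation.TransGen.trans (h1 δ hδ) (h2 δ hδ)

theorem apR_mono {F : (Fin d → ℝ) → Fin d → ℝ} {M M0 : Set (Fin d → ℝ)} {δ δ' : ℝ}
    {a b : Fin d → ℝ} (hδ : δ ≤ δ') (h : apR F M M0 δ a b) : apR F M M0 δ' a b :=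
  Relation.TransGen.mono (r := apStep F M M0 δ) (p := apStep F M M0 δ')
    (fun _ _ ⟨h1, h2, h3, h4⟩ => ⟨h1, h2, h3, h4.trans_le hδ⟩) _ _ h

theorem apR_pen {F : (Fin d → ℝ) → Fin d → ℝ} {M M0 : Set (Fin d → ℝ)} {δ : ℝ}
    {a b : Fin d → ℝ} (h : apR F M M0 δ a b) :
    ∃ p, (p = a ∨ apR F M M0 δ a p) ∧ apStep F M M0 δ p b := by
  unfold apR at h
  rw [Relation.TransGen.tail'_iff] at h
  obtain ⟨p, hp, hs⟩ := h
  exact ⟨p, Relation.reflTransGen_iff_eq_or_transGen.1 hp, hs⟩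

theorem apR_append {F : (Fin d → ℝ) → Fin d → ℝ} {M M0 : Set (Fin d → ℝ)} {δ : ℝ}
    {a p b : Fin d → ℝ} (h : p = a ∨ apR F M M0 δ a p) (hs : apStep F M M0 δ p b) :
    apR F M M0 δ a b := by
  rcases h with rfl | h
  · exact Relation.TransGen.single hs
  · exact Relation.TransGen.tail h hs

theorem apR_mem {F : (Fin d → ℝ) → Fin d → ℝ} {M M0 : Set (Fin d → ℝ)} {δ : ℝ}
    {a b : Fin d → ℝ} (h : apR F M M0 δ a b) : b ∈ M := by
  obtain ⟨p, -, hp⟩ := apR_pen h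
  exact hp.2.1

theorem apR_norm {F : (Fin d → ℝ) → Fin d → ℝ} {M M0 : Set (Fin d → ℝ)} {δ C : ℝ}
    (hC : ∀ x ∈ M, ‖F x‖ ≤ C)
    {a b : Fin d → ℝ} (h : apR F M M0 δ a b) : b ∈ closedBall (0 : Fin d → ℝ) (C + δ) := by
  obtain ⟨p, -, hp⟩ := apR_pen h
  rw [mem_closedBall]
  have h1 := dist_triangle b (F p) 0
  have h2 := hC p hp.1
  rw [dist_zero_right (F p)] at h1
  linarith [hp.2.2.2]

theorem apStep_F {F : (Fin d → ℝ) → Fin d → ℝ} {M M0 : Set (Fin d → ℝ)} {δ : ℝ} (hδ : 0 < δ)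
    (hFmap : MapsTo F M M) (hFM0 : MapsTo F M0 M0) {a : Fin d → ℝ} (ha : a ∈ M) :
    apStep F M M0 δ a (F a) :=
  ⟨ha, hFmap ha, fun h => hFM0 h, by simpa using hδ⟩

theorem apR_F {F : (Fin d → ℝ) → Fin d → ℝ} {M M0 : Set (Fin d → ℝ)} {δ : ℝ} (hδ : 0 < δ)
    (hFmap : MapsTo F M M) (hFM0 : MapsTo F M0 M0) {a b : Fin d → ℝ} (h : apR F M M0 δ a b) :
    apR F M M0 δ a (F b) :=
  apR_append (Or.inr h) (apStep_F hδ hFmap hFM0 (apR_mem h))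

theorem apR_iter {F : (Fin d → ℝ) → Fin d → ℝ} {M M0 : Set (Fin d → ℝ)} {δ : ℝ} (hδ : 0 < δ)
    (hFmap : MapsTo F M M) (hFM0 : MapsTo F M0 M0) {a b : Fin d → ℝ}
    (h : b = a ∨ apR F M M0 δ a b) (hb : b ∈ M) (n : ℕ) :
    (F^[n] b = a ∨ apR F M M0 δ a (F^[n] b)) ∧ (n = 0 ∨ apR F M M0 δ a (F^[n] b)) := by
  induction n with
  | zero => simpa using h
  | succ n ih =>
    rw [Function.iterate_succ_apply']
    have : apR F M M0 δ a (F (F^[n] b)) :=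
      apR_append ih.1 (apStep_F hδ hFmap hFM0 (hFmap.iterate n hb))
    exact ⟨Or.inr this, Or.inr this⟩

/-- ω-limit points. -/
theorem omega_le {F : (Fin d → ℝ) → Fin d → ℝ} {M M0 : Set (Fin d → ℝ)}
    (hMcl : IsClosed M) (hM0cl : IsClosed M0)
    (hFmap : MapsTo F M M) (hFcont : ContinuousOn F M)
    (hFM0 : MapsTo F M0 M0) (hFM1 : MapsTo F (M \ M0) (M \ M0))
    {y z : Fin d → ℝ} (hy : y ∈ M) (hz : MapClusterPt z atTop (fun n => F^[n] y)) :
    z ∈ M ∧ (y ∈ M0 → z ∈ M0) ∧ apLe F M M0 y z ∧ ((z ∈ M0 → y ∈ M0) → apLe F M M0 z z) := by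
  have hcl : ∀ T : Set (Fin d → ℝ), IsClosed T → (∀ n, F^[n] y ∈ T) → z ∈ T := by
    intro T hT h
    exact hT.mem_of_mapClusterPt hz (Eventually.of_forall h)
  have hfreq : ∀ ε > 0, ∀ N, ∃ n ≥ N, dist (F^[n] y) z < ε := by
    intro ε hε N
    have := (mapClusterPt_iff_frequently.1 hz) _ (ball_mem_nhds z hε)
    exact (frequently_atTop.1 this) N
  have hM : ∀ n, F^[n] y ∈ M := fun n => hFmap.iterate n hy
  have hzM : z ∈ M := hcl M hMcl hM
  have h00 : y ∈ M0 → z ∈ M0 := fun h => hcl M0 hM0cl (fun n => hFM0.iterate n h)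
  have hback : ∀ n, F^[n] y ∈ M0 → z ∈ M0 := by
    intro n hn
    by_contra hzz
    have : y ∈ M \ M0 := ⟨hy, fun h => hzz (h00 h)⟩
    exact (hFM1.iterate n this).2 hn
  have hlast : ∀ δ > 0, ∀ n, dist (F^[n+1] y) z < δ → apStep F M M0 δ (F^[n] y) z := by
    intro δ hδ n hn
    refine ⟨hM n, hzM, hback n, ?_⟩
    rw [Function.iterate_succ_apply'] at hn
    rwa [dist_comm]
  refine ⟨hzM, h00, ?_, ?_⟩
  · rw [apLe_iff]
    intro δ hδ
    obtain ⟨n, hn, hd⟩ := hfreq δ hδ 1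
    obtain ⟨k, rfl⟩ : ∃ k, n = k + 1 := ⟨n - 1, by omega⟩
    exact apR_append (apR_iter hδ hFmap hFM0 (Or.inl rfl) hy k).1 (hlast δ hδ k hd)
  · intro h0
    rw [apLe_iff]
    intro δ hδ
    obtain ⟨η, hη, hc⟩ := Metric.continuousOn_iff.1 hFcont z hzM δ hδ
    obtain ⟨m, -, hm⟩ := hfreq η hη 0
    obtain ⟨n, hn, hd⟩ := hfreq δ hδ (m + 2)
    obtain ⟨k, rfl⟩ : ∃ k, n = (k + (m + 1)) + 1 := ⟨n - m - 2, by omega⟩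
    have s1 : apStep F M M0 δ z (F^[m+1] y) := by
      refine ⟨hzM, hM _, fun h => hFM0.iterate _ (h0 h), ?_⟩
      rw [Function.iterate_succ_apply']
      exact hc _ (hM m) hm
    have s2 := (apR_iter hδ hFmap hFM0 (Or.inr (Relation.TransGen.single s1)) (hM _) k).1
    rw [← Function.iterate_add_apply] at s2
    exact apR_append s2 (hlast δ hδ _ hd)

theorem exists_omega {F : (Fin d → ℝ) → Fin d → ℝ} {M : Set (Fin d → ℝ)}
    (hFmap : MapsTo F M M) {C : ℝ} (hC : ∀ x ∈ M, ‖F x‖ ≤ C)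
    {y : Fin d → ℝ} (hy : y ∈ M) : ∃ z, MapClusterPt z atTop (fun n => F^[n] y) := by
  have hc : IsCompact (closedBall (0 : Fin d → ℝ) C) := isCompact_closedBall _ _
  have : ∀ᶠ n in atTop, F^[n] y ∈ closedBall (0 : Fin d → ℝ) C := by
    filter_upwards [eventually_ge_atTop 1] with n hn
    obtain ⟨k, rfl⟩ : ∃ k, n = k + 1 := ⟨n - 1, by omega⟩
    rw [Function.iterate_succ_apply', mem_closedBall, dist_zero_right]
    exact hC _ (hFmap.iterate k hy)
  obtain ⟨z, -, hz⟩ := hc.exists_mapClusterPt_of_frequently this.frequently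
  exact ⟨z, hz⟩

theorem apLe_limit {F : (Fin d → ℝ) → Fin d → ℝ} {M M0 : Set (Fin d → ℝ)}
    (hM0cl : IsClosed M0) {x y : Fin d → ℝ} (hy : y ∈ M)
    (h : ∀ ε > 0, ∃ u, dist u y < ε ∧ apR F M M0 ε x u) : apLe F M M0 x y := by
  rw [apLe_iff]
  intro δ hδ
  obtain ⟨η, hη, hη0⟩ : ∃ η > 0, ∀ u, dist u y < η → u ∈ M0 → y ∈ M0 := by
    by_cases hy0 : y ∈ M0
    · exact ⟨1, one_pos, fun _ _ _ => hy0⟩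
    · obtain ⟨η, hη, hb⟩ := Metric.isOpen_iff.1 hM0cl.isOpen_compl y hy0
      exact ⟨η, hη, fun u hu h0 => absurd h0 (hb hu)⟩
  obtain ⟨u, hu, hr⟩ := h (min η (δ / 2)) (by positivity)
  obtain ⟨p, hp, hs⟩ := apR_pen hr
  have e1 := min_le_left η (δ / 2)
  have e2 := min_le_right η (δ / 2)
  have hp' : p = x ∨ apR F M M0 δ x p := hp.imp_right (apR_mono (by linarith))
  refine apR_append hp' ⟨hs.1, hy, fun h0 => hη0 u (by linarith) (hs.2.2.1 h0), ?_⟩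
  have := dist_triangle y u (F p)
  rw [dist_comm y u] at this
  linarith [hs.2.2.2]

theorem apR_nhd {F : (Fin d → ℝ) → Fin d → ℝ} {M M0 : Set (Fin d → ℝ)}
    (hMcl : IsClosed M) (hM0cl : IsClosed M0) {C : ℝ} (hC : ∀ x ∈ M, ‖F x‖ ≤ C)
    {x : Fin d → ℝ} {V : Set (Fin d → ℝ)} (hV : IsOpen V) (hxV : ∀ y, apLe F M M0 x y → y ∈ V) :
    ∃ δ > 0, ∀ y, apR F M M0 δ x y → y ∈ V := by
  by_contra hcon
  push Not at hcon
  have hpos : ∀ k : ℕ, (0 : ℝ) < 1 / ((k : ℝ) + 1) := fun k => Nat.one_div_pos_of_nat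
  choose u hu huV using fun k : ℕ => hcon (1 / ((k : ℝ) + 1)) (hpos k)
  have hle : ∀ k : ℕ, 1 / ((k : ℝ) + 1) ≤ 1 := by
    intro k
    rw [div_le_one (by positivity)]
    have : (0 : ℝ) ≤ k := by positivity
    linarith
  have hc : IsCompact (closedBall (0 : Fin d → ℝ) (C + 1) ∩ (M ∩ Vᶜ)) :=
    (isCompact_closedBall _ _).inter_right (hMcl.inter hV.isClosed_compl)
  obtain ⟨y, ⟨-, hyM, hyV⟩, φ, hφ, ht⟩ := hc.tendsto_subseq
    (x := u) (fun k => ⟨apR_norm hC (apR_mono (hle k) (hu k)), apR_mem (hu k), huV k⟩)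
  apply hyV
  apply hxV
  apply apLe_limit hM0cl hyM
  intro ε hε
  have h1 := (Metric.tendsto_nhds.1 ht) ε hε
  have h2 : ∀ᶠ k in atTop, 1 / (((φ k : ℕ) : ℝ) + 1) < ε :=
    (tendsto_one_div_add_atTop_nhds_zero_nat.comp hφ.tendsto_atTop).eventually_lt_const hε
  obtain ⟨k, hk1, hk2⟩ := (h1.and h2).exists
  exact ⟨u (φ k), hk1, apR_mono hk2.le (hu _)⟩

/-- Chains reaching only `M \ M0` reach a relatively open set. -/
theorem apR_thick {F : (Fin d → ℝ) → Fin d → ℝ} {M M0 : Set (Fin d → ℝ)} {δ : ℝ}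
    {x : Fin d → ℝ} (hxx : apR F M M0 δ x x) (hW : ∀ y, apR F M M0 δ x y → y ∉ M0) :
    ∀ y, (y ∈ thickening δ (F '' {w | apR F M M0 δ x w}) ∧ y ∈ M) ↔ apR F M M0 δ x y := by
  intro y
  constructor
  · rintro ⟨hy, hyM⟩
    obtain ⟨_, ⟨w, hw, rfl⟩, hd⟩ := mem_thickening_iff.1 hy
    exact apR_append (Or.inr hw) ⟨apR_mem hw, hyM, fun h => absurd h (hW w hw), hd⟩
  · intro h
    refine ⟨?_, apR_mem h⟩
    obtain ⟨p, hp, hs⟩ := apR_pen h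
    refine mem_thickening_iff.2 ⟨F p, ⟨p, ?_, rfl⟩, hs.2.2.2⟩
    rcases hp with rfl | hp
    · exact hxx
    · exact hp

theorem stmt6 (d : ℕ) (M M0 : Set (Fin d → ℝ)) (F : (Fin d → ℝ) → Fin d → ℝ)
    (hMcl : IsClosed M) (hM0cl : IsClosed M0) (hM0M : M0 ⊆ M)
    (hFmap : MapsTo F M M) (hFcont : ContinuousOn F M)
    (hFbdd : ∃ C : ℝ, ∀ x ∈ M, ‖F x‖ ≤ C)
    (hFM0 : MapsTo F M0 M0) (hFM1 : MapsTo F (M \ M0) (M \ M0))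
    (x : Fin d → ℝ) (hx : IsApQuasiattractor F M M0 x)
    (hxM1 : apClass F M M0 x ⊆ M \ M0)
    (hiso : ∃ U : Set (Fin d → ℝ), IsOpen U ∧ apClass F M M0 x ⊆ U ∧
      ∀ y ∈ apRec F M M0, y ∈ U → y ∈ apClass F M M0 x) :
    IsAttractor F M (apClass F M M0 x) := by
  obtain ⟨C, hC⟩ := hFbdd
  obtain ⟨Ui, hUio, hUiK, hUi⟩ := hiso
  obtain ⟨hxx, hmax⟩ := hx
  set K := apClass F M M0 x with hK
  have hRKle : ∀ z, apLe F M M0 x z → apLe F M M0 z z → z ∈ K :=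
    fun z h1 h2 => ⟨⟨h2, h2⟩, hmax z ⟨h2, h2⟩ h1⟩
  have hmemM : ∀ z, apLe F M M0 x z → z ∈ M := fun z h =>
    apR_mem ((apLe_iff F M M0 x z).1 h 1 one_pos)
  -- no point of M0 is above x
  have hno0 : ∀ y, apLe F M M0 x y → y ∉ M0 := by
    intro y hy hy0
    obtain ⟨z, hz⟩ := exists_omega hFmap hC (hmemM y hy)
    obtain ⟨-, h1, h2, h3⟩ := omega_le hMcl hM0cl hFmap hFcont hFM0 hFM1 (hmemM y hy) hz
    exact (hxM1 (hRKle z (apLe_trans hy h2) (h3 fun _ => hy0))).2 (h1 hy0)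
  have hKle : ∀ y, apLe F M M0 x y → y ∈ K := by
    intro y hy
    obtain ⟨z, hz⟩ := exists_omega hFmap hC (hmemM y hy)
    obtain ⟨-, h1, h2, h3⟩ := omega_le hMcl hM0cl hFmap hFcont hFM0 hFM1 (hmemM y hy) hz
    have hxz := apLe_trans hy h2
    have hzK : z ∈ K := hRKle z hxz (h3 fun h => absurd h (hno0 z hxz))
    have hyx := apLe_trans h2 hzK.2.2
    have hyy := apLe_trans hyx hy
    exact ⟨⟨hyy, hyy⟩, hy, hyx⟩
  have hleK : ∀ y ∈ K, ∀ δ > 0, apR F M M0 δ x y := fun y hy => (apLe_iff F M M0 x y).1 hy.2.1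
  have hxR : ∀ δ > 0, apR F M M0 δ x x := (apLe_iff F M M0 x x).1 hxx.1
  have hKM : K ⊆ M := fun y hy => (hxM1 hy).1
  have hKcl : IsClosed K := by
    rw [← isSeqClosed_iff_isClosed]
    intro u y hu ht
    apply hKle
    apply apLe_limit hM0cl (hMcl.mem_of_tendsto ht (Eventually.of_forall fun n => hKM (hu n)))
    intro ε hε
    obtain ⟨k, hk⟩ := ((Metric.tendsto_nhds.1 ht) ε hε).exists
    exact ⟨u k, hk, hleK _ (hu k) ε hε⟩
  have hKc : IsCompact K := (isCompact_closedBall (0 : Fin d → ℝ) (C + 1)).of_isClosed_subset hKcl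
    (fun y hy => apR_norm hC (hleK y hy 1 one_pos))
  have hFK : MapsTo F K K := by
    intro y hy
    apply hKle
    rw [apLe_iff]
    exact fun δ hδ => apR_F hδ hFmap hFM0 (hleK y hy δ hδ)
  have hKF : ∀ y ∈ K, ∃ w ∈ K, F w = y := by
    intro y hy
    by_contra hcon
    push Not at hcon
    have hFKc : IsCompact (F '' K) := hKc.image_of_continuousOn (hFcont.mono hKM)
    have hyn : y ∉ F '' K := by
      rintro ⟨w, hw, e⟩
      exact hcon w hw e
    obtain ⟨ε, hε, hb⟩ := Metric.isOpen_iff.1 hFKc.isClosed.isOpen_compl y hyn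
    -- open neighborhood of K on which F stays far from y
    have hopen : ∃ V, IsOpen V ∧ K ⊆ V ∧ ∀ w ∈ V ∩ M, ε / 2 < dist y (F w) := by
      have hco : ContinuousOn (fun w => dist y (F w)) M :=
        (continuous_const.dist continuous_id).comp_continuousOn hFcont
      obtain ⟨V, hV, hVe⟩ := (_root_.continuousOn_iff'.1 hco) (Ioi (ε / 2)) isOpen_Ioi
      refine ⟨V, hV, fun w hw => ?_, fun w hw => ?_⟩
      · have : w ∈ (fun w => dist y (F w)) ⁻¹' Ioi (ε / 2) ∩ M := by
          refine ⟨?_, hKM hw⟩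
          show ε / 2 < dist y (F w)
          by_contra hlt
          push Not at hlt
          exact hb (show F w ∈ ball y ε by rw [mem_ball, dist_comm]; linarith) ⟨w, hw, rfl⟩
        rw [hVe] at this
        exact this.1
      · rw [← hVe] at hw
        exact hw.1
    obtain ⟨V, hV, hKV, hVd⟩ := hopen
    obtain ⟨δ, hδ, hδV⟩ := apR_nhd hMcl hM0cl hC hV (fun y h => hKV (hKle y h))
    have hm : 0 < min δ (ε / 2) := by positivity
    obtain ⟨p, hp, hs⟩ := apR_pen (hleK y hy _ hm)
    have hpR : apR F M M0 (min δ (ε / 2)) x p := by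
      rcases hp with rfl | hp
      · exact hxR _ hm
      · exact hp
    have := hVd p ⟨hδV p (apR_mono (min_le_left _ _) hpR), hs.1⟩
    linarith [hs.2.2.2, min_le_right δ (ε / 2)]
  have hKFn : ∀ n, ∀ y ∈ K, ∃ w ∈ K, F^[n] w = y := by
    intro n
    induction n with
    | zero => exact fun y hy => ⟨y, hy, rfl⟩
    | succ n ih =>
      intro y hy
      obtain ⟨w, hw, rfl⟩ := ih y hy
      obtain ⟨v, hv, rfl⟩ := hKF w hw
      exact ⟨v, hv, rfl⟩
  -- choice of the neighborhood
  have hU0 : IsOpen (Ui ∩ M0ᶜ) := hUio.inter hM0cl.isOpen_compl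
  have hKU0 : K ⊆ Ui ∩ M0ᶜ := fun y hy => ⟨hUiK hy, (hxM1 hy).2⟩
  obtain ⟨r, hr, hrU⟩ := hKc.exists_cthickening_subset_open hU0 hKU0
  obtain ⟨δ, hδ, hδV⟩ := apR_nhd hMcl hM0cl hC (isOpen_thickening (δ := r) (E := K))
    (fun y h => self_subset_thickening hr K (hKle y h))
  set W := {w | apR F M M0 δ x w} with hWdef
  have hWcl : closure W ⊆ Ui ∩ M0ᶜ := by
    refine (closure_minimal ?_ isClosed_cthickening).trans hrU
    exact fun y hy => thickening_subset_cthickening _ _ (hδV y hy)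
  have hW0 : ∀ y, apR F M M0 δ x y → y ∉ M0 := fun y hy => (hWcl (subset_closure hy)).2
  have hUM : thickening δ (F '' W) ∩ M = W := by
    ext y
    exact apR_thick (hxR δ hδ) hW0 y
  have hattr : ∀ V : Set (Fin d → ℝ), IsOpen V → K ⊆ V →
      ∃ N : ℕ, ∀ n ≥ N, F^[n] '' (thickening δ (F '' W) ∩ M) ⊆ V := by
    intro V hV hKV
    rw [hUM]
    obtain ⟨δ', hδ', hδV'⟩ := apR_nhd hMcl hM0cl hC (hV.inter hM0cl.isOpen_compl)
      (fun y h => ⟨hKV (hKle y h), hno0 y h⟩)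
    have hth := apR_thick (hxR δ' hδ') (fun y hy => (hδV' y hy).2)
    set U' := thickening δ' (F '' {w | apR F M M0 δ' x w}) with hU'
    have hU'o : IsOpen U' := isOpen_thickening
    have hinv : ∀ y, apR F M M0 δ' x y → ∀ n, apR F M M0 δ' x (F^[n] y) := by
      intro y hy n
      induction n with
      | zero => exact hy
      | succ n ih =>
        rw [Function.iterate_succ_apply']
        exact apR_F hδ' hFmap hFM0 ih
    have hinvW : ∀ y ∈ W, ∀ n, F^[n] y ∈ W := by
      intro y hy n
      induction n with
      | zero => exact hy
      | succ n ih =>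
        rw [Function.iterate_succ_apply']
        exact apR_F hδ hFmap hFM0 ih
    suffices h : ∃ N, ∀ y ∈ W, apR F M M0 δ' x (F^[N] y) by
      obtain ⟨N, hN⟩ := h
      refine ⟨N, ?_⟩
      rintro n hn _ ⟨y, hy, rfl⟩
      obtain ⟨k, rfl⟩ : ∃ k, n = k + N := ⟨n - N, by omega⟩
      rw [Function.iterate_add_apply]
      exact (hδV' _ (hinv _ (hN y hy) k)).1
    by_contra hcon
    push Not at hcon
    choose u huW hu using hcon
    have huM : ∀ n, u n ∈ M := fun n => apR_mem (huW n)
    have hc : IsCompact (closedBall (0 : Fin d → ℝ) (C + δ) ∩ M) :=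
      (isCompact_closedBall _ _).inter_right hMcl
    obtain ⟨y, ⟨-, hyM⟩, φ, hφ, ht⟩ := hc.tendsto_subseq
      (x := u) (fun k => ⟨apR_norm hC (huW k), huM k⟩)
    have hcn : ∀ j, ContinuousOn (F^[j]) M := fun j => hFcont.iterate hFmap j
    have htj : ∀ j, Tendsto (fun k => F^[j] (u (φ k))) atTop (𝓝 (F^[j] y)) := by
      intro j
      exact ((hcn j) y hyM).tendsto.comp (tendsto_nhdsWithin_iff.2
        ⟨ht, Eventually.of_forall fun k => huM _⟩)
    have hjW : ∀ j, F^[j] y ∈ closure W := fun j =>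
      mem_closure_of_tendsto (htj j) (Eventually.of_forall fun k => hinvW _ (huW _) j)
    have hjU : ∀ j, F^[j] y ∈ U'ᶜ := by
      intro j
      refine hU'o.isClosed_compl.mem_of_tendsto (htj j) ?_
      filter_upwards [eventually_ge_atTop j] with k hk hmem
      have h1 := (hth _).1 ⟨hmem, hFmap.iterate j (huM (φ k))⟩
      apply hu (φ k)
      obtain ⟨i, hi⟩ : ∃ i, φ k = i + j := ⟨φ k - j, by have := hφ.le_apply (x := k); omega⟩
      have h2 := hinv _ h1 i
      rw [← Function.iterate_add_apply, ← hi] at h2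
      exact h2
    obtain ⟨z, hz⟩ := exists_omega hFmap hC hyM
    obtain ⟨-, h1, h2, h3⟩ := omega_le hMcl hM0cl hFmap hFcont hFM0 hFM1 hyM hz
    have hzW : z ∈ Ui ∩ M0ᶜ :=
      hWcl (isClosed_closure.mem_of_mapClusterPt hz (Eventually.of_forall hjW))
    have hzU : z ∈ U'ᶜ :=
      hU'o.isClosed_compl.mem_of_mapClusterPt hz (Eventually.of_forall hjU)
    have hzz := h3 (fun h => absurd h hzW.2)
    have hzK : z ∈ K := hUi z ⟨hzz, hzz⟩ hzW.1
    exact hzU ((hth z).2 (hleK z hzK δ' hδ')).1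
  have hKW : K ⊆ thickening δ (F '' W) ∩ M := by
    rw [hUM]
    exact fun y hy => hleK y hy δ hδ
  refine ⟨hKc, hKM, thickening δ (F '' W), isOpen_thickening, fun y hy => (hKW hy).1, ?_, hattr⟩
  apply Subset.antisymm
  · intro y hy
    by_contra hyK
    obtain ⟨N, hN⟩ := hattr {y}ᶜ isOpen_compl_singleton (by
      rintro w hw rfl
      exact hyK hw)
    have := mem_iInter₂.1 hy (N + 1) (by simp)
    exact hN (N + 1) (by omega) this rfl
  · intro y hy
    refine mem_iInter₂.2 fun n _ => ?_
    obtain ⟨w, hw, e⟩ := hKFn n y hy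
    exact ⟨w, hKW hw, e⟩

end QSDPaper
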